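/- Fix integers θ ≥ 2 and k ≥ 1, and let (Y_n)_{n≥0} be the global containment profile process of the hyperrecursive tree with parameter θ, truncated at level k. Let A be the (k+1)×(k+1) core matrix of the hyperrecursive-tree urn. Then for every n ≥ 1, E[Y_n | F_{n−1}] = Y_{n−1} (I_{k+1} + (1/(n−1+θ)) A) almost surely, i.e., coordinatewise E[Y_{n,j} | F_{n−1}] = Y_{n−1,j} + (1/(n−1+θ)) Σ_{i=1}^{k+1} Y_{n−1,i} A_{i,j}. -/

import Mathlib

open MeasureTheory Finset

/-- The replacement vector `a_s = (1 − s_1, s_1 − s_2, …, s_{k−1} − s_k, s_k) ∈ ℤ^{k+1}`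
of the hyperrecursive-tree urn (0-indexed). -/
def replVecZ (k : ℕ) (s : Fin (k + 1) → ℕ) : Fin (k + 1) → ℤ := fun j =>
  if j.val = 0 then 1 - (s 0 : ℤ)
  else if j.val = k then (s ⟨k - 1, by omega⟩ : ℤ)
  else (s ⟨j.val - 1, by omega⟩ : ℤ) - (s j : ℤ)

/-- The core matrix `A` of the hyperrecursive-tree urn with parameter `θ` and `k+1`
colors (0-indexed): first row `(−(θ−2), θ−1, 0, …, 0)`; for `2 ≤ i ≤ k` the `i`-th row
has first entry `1`, entry `−(θ−1)` in position `i`, entry `θ−1` in position `i+1`,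
zeros elsewhere; last row `(1, 0, …, 0)`. -/
def coreMatrix (θ k : ℕ) : Matrix (Fin (k + 1)) (Fin (k + 1)) ℤ := fun i j =>
  if i.val = 0 then
    (if j.val = 0 then -((θ : ℤ) - 2) else if j.val = 1 then (θ : ℤ) - 1 else 0)
  else if i.val = k then
    (if j.val = 0 then 1 else 0)
  else
    (if j.val = 0 then 1
     else if j = i then -((θ : ℤ) - 1)
     else if j.val = i.val + 1 then (θ : ℤ) - 1
     else 0)

/-- The coefficient of a finite product of power series, as a sum over `piAntidiag`. -/
lemma sum_piAntidiag_prod_coeff {ι R : Type*} [Fintype ι] [DecidableEq ι] [CommSemiring R]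
    (f : ι → PowerSeries R) (d : ℕ) :
    ∑ s ∈ piAntidiag univ d, ∏ i, PowerSeries.coeff (s i) (f i) =
      PowerSeries.coeff d (∏ i, f i) := by
  rw [PowerSeries.coeff_prod]
  refine Finset.sum_bij' (fun s _ => Finsupp.equivFunOnFinite.symm s) (fun s _ => ⇑s) ?_ ?_ ?_ ?_ ?_
  · intro s hs
    simpa [mem_finsuppAntidiag] using hs
  · intro s hs
    simpa [mem_finsuppAntidiag] using hs
  · intro s hs; rfl
  · intro s hs; ext; rfl
  · intro s hs; rfl

lemma PowerSeries.coeff_one_add_X_pow_nat (n r : ℕ) :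
    PowerSeries.coeff r ((1 + PowerSeries.X : PowerSeries ℕ) ^ n) = n.choose r := by
  have h := Polynomial.coeff_one_add_X_pow ℕ n r
  rw [← Polynomial.coeff_coe] at h
  simpa using h

/-- The multivariate Vandermonde identity. -/
lemma sum_piAntidiag_prod_choose {ι : Type*} [Fintype ι] [DecidableEq ι] (y : ι → ℕ) (m : ℕ) :
    ∑ s ∈ piAntidiag univ m, ∏ i, (y i).choose (s i) = (∑ i, y i).choose m := by
  have h := sum_piAntidiag_prod_coeff (fun i => (1 + PowerSeries.X : PowerSeries ℕ) ^ y i) m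
  simpa [PowerSeries.coeff_one_add_X_pow_nat, Finset.prod_pow_eq_pow_sum] using h

lemma PowerSeries.coeff_succ_mul_X_mul_one_add_X_pow (t r : ℕ) :
    PowerSeries.coeff r
      ((t + 1) • (PowerSeries.X * (1 + PowerSeries.X : PowerSeries ℕ) ^ t)) =
      r * (t + 1).choose r := by
  rcases r with _ | r
  · simp
  · rw [map_nsmul, PowerSeries.coeff_succ_X_mul, PowerSeries.coeff_one_add_X_pow_nat,
      smul_eq_mul, Nat.add_one_mul_choose_eq, mul_comm]

/-- The first moment of the multivariate hypergeometric weights. -/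
lemma sum_piAntidiag_mul_prod_choose {ι : Type*} [Fintype ι] [DecidableEq ι] (y : ι → ℕ) (m : ℕ)
    (j : ι) :
    (∑ i, y i) * ∑ s ∈ piAntidiag univ m, s j * ∏ i, (y i).choose (s i) =
      m * y j * (∑ i, y i).choose m := by
  rcases hy : y j with _ | t
  · have h0 : ∑ s ∈ piAntidiag univ m, s j * ∏ i, (y i).choose (s i) = 0 := by
      refine Finset.sum_eq_zero fun s _ => ?_
      rcases hs : s j with _ | r
      · simp
      · rw [Finset.prod_eq_zero (Finset.mem_univ j), mul_zero]
        simp [hy, hs]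
    simp [h0]
  · have h := sum_piAntidiag_prod_coeff
      (fun i => if i = j then (t + 1) • (PowerSeries.X * (1 + PowerSeries.X : PowerSeries ℕ) ^ t)
        else (1 + PowerSeries.X : PowerSeries ℕ) ^ y i) m
    have hsum : ∑ i, y i = (t + ∑ i ∈ univ.erase j, y i) + 1 := by
      rw [← Finset.add_sum_erase _ _ (Finset.mem_univ j), hy]; ring
    have hprod : (∏ i, if i = j then
          (t + 1) • (PowerSeries.X * (1 + PowerSeries.X : PowerSeries ℕ) ^ t)
        else (1 + PowerSeries.X : PowerSeries ℕ) ^ y i) =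
        (t + 1) • (PowerSeries.X * (1 + PowerSeries.X) ^ (t + ∑ i ∈ univ.erase j, y i)) := by
      rw [← Finset.mul_prod_erase _ _ (Finset.mem_univ j), if_pos rfl, pow_add,
        ← Finset.prod_pow_eq_pow_sum, ← mul_assoc, smul_mul_assoc]
      congr 2
      exact Finset.prod_congr rfl fun i hi => if_neg (Finset.ne_of_mem_erase hi)
    have hterm : ∀ s : ι → ℕ, ∏ i, PowerSeries.coeff (s i) (if i = j then
          (t + 1) • (PowerSeries.X * (1 + PowerSeries.X : PowerSeries ℕ) ^ t)
        else (1 + PowerSeries.X : PowerSeries ℕ) ^ y i) = s j * ∏ i, (y i).choose (s i) := by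
      intro s
      rw [← Finset.mul_prod_erase _ _ (Finset.mem_univ j),
        ← Finset.mul_prod_erase _ (fun i => (y i).choose (s i)) (Finset.mem_univ j), if_pos rfl,
        PowerSeries.coeff_succ_mul_X_mul_one_add_X_pow, hy, mul_assoc]
      congr 2
      refine Finset.prod_congr rfl fun i hi => ?_
      rw [if_neg (Finset.ne_of_mem_erase hi), PowerSeries.coeff_one_add_X_pow_nat]
    rw [hprod] at h
    simp only [hterm] at h
    rw [h, hsum]
    rcases m with _ | r
    · simp
    · rw [map_nsmul, PowerSeries.coeff_succ_X_mul, PowerSeries.coeff_one_add_X_pow_nat, smul_eq_mul,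
        mul_left_comm, Nat.add_one_mul_choose_eq]
      ring

lemma replVecZ_eq {k : ℕ} (hk : 1 ≤ k) (s : Fin (k + 1) → ℕ) (j : Fin (k + 1)) :
    replVecZ k s j = (if j.val = 0 then 1 else (s ⟨j.val - 1, by omega⟩ : ℤ)) -
      (if j.val = k then 0 else (s j : ℤ)) := by
  unfold replVecZ
  by_cases h0 : j.val = 0
  · have hj : j = 0 := Fin.ext h0
    subst hj
    have hk0 : ¬ (0 = k) := by omega
    simp [hk0]
  · by_cases h1 : j.val = k
    · have hk0 : k ≠ 0 := by omega
      simp [h1, hk0]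
    · simp [h0, h1]

lemma sum_replVecZ {k : ℕ} (hk : 1 ≤ k) (s : Fin (k + 1) → ℕ) : ∑ j, replVecZ k s j = 1 := by
  let t : Fin (k + 1) → ℤ := fun i => if i.val = k then 0 else (s i : ℤ)
  have h1 : ∑ i, t i = ∑ i : Fin k, t i.castSucc := by
    rw [Fin.sum_univ_castSucc]; simp [t]
  have h2 : ∑ j : Fin (k + 1), (if j.val = 0 then 1 else (s ⟨j.val - 1, by omega⟩ : ℤ)) =
      1 + ∑ i : Fin k, t i.castSucc := by
    rw [Fin.sum_univ_succ]
    congr 1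
    refine Finset.sum_congr rfl fun i _ => ?_
    have : i.val ≠ k := i.isLt.ne
    simp [t, this, Fin.castSucc, Fin.castAdd, Fin.castLE]
  simp only [replVecZ_eq hk, Finset.sum_sub_distrib]
  rw [h2, ← h1]
  simp [t]

lemma replVecZ_inj {k : ℕ} (hk : 1 ≤ k) {s t : Fin (k + 1) → ℕ} (hst : ∑ i, s i = ∑ i, t i)
    (h : ∀ j, replVecZ k s j = replVecZ k t j) : s = t := by
  have key : ∀ i : ℕ, ∀ hi : i < k, s ⟨i, by omega⟩ = t ⟨i, by omega⟩ := by
    intro i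
    induction i with
    | zero =>
      intro hi
      have := h ⟨0, by omega⟩
      simp only [replVecZ_eq hk, if_true] at this
      rw [if_neg hi.ne, if_neg hi.ne] at this
      omega
    | succ i ih =>
      intro hi
      have h1 := h ⟨i + 1, by omega⟩
      have h2 := ih (by omega)
      simp only [replVecZ_eq hk] at h1
      rw [if_neg hi.ne, if_neg hi.ne] at h1
      simp at h1
      omega
  have hlast : s (Fin.last k) = t (Fin.last k) := by
    rw [Fin.sum_univ_castSucc, Fin.sum_univ_castSucc] at hst
    have : ∑ i : Fin k, s i.castSucc = ∑ i : Fin k, t i.castSucc :=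
      Finset.sum_congr rfl fun i _ => key i.val i.isLt
    omega
  funext i
  rcases Fin.eq_castSucc_or_eq_last i with ⟨i, rfl⟩ | rfl
  · exact key i.val i.isLt
  · exact hlast

lemma coreMatrix_eq {θ k : ℕ} (hk : 1 ≤ k) (i j : Fin (k + 1)) :
    coreMatrix θ k i j =
      (if j.val = 0 then 1 else if i.val = j.val - 1 then (θ : ℤ) - 1 else 0) -
        (if j.val = k then 0 else if i.val = j.val then (θ : ℤ) - 1 else 0) := by
  unfold coreMatrix
  have hi := i.isLt
  have hj := j.isLt
  simp only [Fin.ext_iff]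
  split_ifs <;> omega

/-- The mean replacement vector under the multivariate hypergeometric weights. -/
lemma sum_replVecZ_mul_prod_choose {θ k : ℕ} (hθ : 1 ≤ θ) (hk : 1 ≤ k) (y : Fin (k + 1) → ℕ) {N : ℕ}
    (hN : 1 ≤ N) (hθN : θ - 1 ≤ N) (hy : ∑ i, y i = N) (j : Fin (k + 1)) :
    ∑ s ∈ piAntidiag univ (θ - 1), (replVecZ k s j : ℝ) *
        ((∏ i, ((y i).choose (s i) : ℝ)) / (N.choose (θ - 1) : ℝ)) =
      1 / (N : ℝ) * ∑ i, (y i : ℝ) * (coreMatrix θ k i j : ℝ) := by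
  have hC : (N.choose (θ - 1) : ℝ) ≠ 0 := by
    exact_mod_cast (Nat.choose_pos hθN).ne'
  have hN0 : (N : ℝ) ≠ 0 := by positivity
  have htot : ∑ s ∈ piAntidiag univ (θ - 1),
      ((∏ i, ((y i).choose (s i) : ℝ)) / (N.choose (θ - 1) : ℝ)) = 1 := by
    rw [← Finset.sum_div, div_eq_one_iff_eq hC, ← hy, ← sum_piAntidiag_prod_choose]
    push_cast; rfl
  have hmean : ∀ l : Fin (k + 1), ∑ s ∈ piAntidiag univ (θ - 1), (s l : ℝ) *
      ((∏ i, ((y i).choose (s i) : ℝ)) / (N.choose (θ - 1) : ℝ)) =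
        1 / (N : ℝ) * (y l * ((θ : ℝ) - 1)) := by
    intro l
    have h := sum_piAntidiag_mul_prod_choose y (θ - 1) l
    rw [hy] at h
    have h' : (N : ℝ) * ∑ s ∈ piAntidiag univ (θ - 1),
        (s l : ℝ) * ∏ i, ((y i).choose (s i) : ℝ) =
        ((θ : ℝ) - 1) * y l * (N.choose (θ - 1) : ℝ) := by
      rw [← Nat.cast_one (R := ℝ), ← Nat.cast_sub hθ]
      exact_mod_cast h
    simp only [← mul_div_assoc]
    rw [← Finset.sum_div, div_eq_iff hC]
    field_simp
    linarith
  have hy' : ∑ i, (y i : ℝ) = N := by exact_mod_cast hy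
  have hcol : ∀ l : Fin (k + 1), ∑ i, (y i : ℝ) * (if i.val = l.val then (θ : ℝ) - 1 else 0) =
      y l * ((θ : ℝ) - 1) := by
    intro l
    simp [← Fin.ext_iff]
  simp only [replVecZ_eq hk, coreMatrix_eq hk]
  push_cast
  simp only [sub_mul, mul_sub, Finset.sum_sub_distrib]
  congr 1
  · by_cases h0 : j.val = 0
    · simp only [h0, if_true, one_mul, mul_one, htot, hy']
      field_simp
    · simp only [h0, if_false]
      rw [hmean, ← hcol]
  · by_cases h1 : j.val = k
    · simp [h1]
    · simp only [h1, if_false]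
      rw [hmean, ← hcol]

/-- One urn step from a state of known total almost surely uses one of the replacement vectors. -/
lemma ae_exists_replVecZ {Ω : Type*} {m0 : MeasurableSpace Ω} {μ : Measure Ω}
    [IsProbabilityMeasure μ] {θ k N : ℕ} (hk : 1 ≤ k) (hθN : θ - 1 ≤ N)
    {m : MeasurableSpace Ω} (hm : m ≤ m0) {y z : Ω → Fin (k + 1) → ℕ}
    (hint : ∀ s : Fin (k + 1) → ℕ, Integrable (fun ω => if (∀ j : Fin (k + 1),
      (z ω j : ℤ) = (y ω j : ℤ) + replVecZ k s j) then (1 : ℝ) else 0) μ)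
    (hcond : ∀ s : Fin (k + 1) → ℕ, (∑ i, s i = θ - 1) →
      (μ[(fun ω => if (∀ j : Fin (k + 1),
            (z ω j : ℤ) = (y ω j : ℤ) + replVecZ k s j)
          then (1 : ℝ) else 0) | m]) =ᵐ[μ]
        (fun ω => (∏ j, ((y ω j).choose (s j) : ℝ)) / (N.choose (θ - 1) : ℝ)))
    (htot : ∀ᵐ ω ∂μ, ∑ j, y ω j = N) :
    ∀ᵐ ω ∂μ, ∃ s ∈ piAntidiag univ (θ - 1),
      ∀ j, (z ω j : ℤ) = (y ω j : ℤ) + replVecZ k s j := by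
  classical
  set I : (Fin (k + 1) → ℕ) → Ω → ℝ := fun s ω => if (∀ j : Fin (k + 1),
      (z ω j : ℤ) = (y ω j : ℤ) + replVecZ k s j) then (1 : ℝ) else 0 with hI
  have hC : (N.choose (θ - 1) : ℝ) ≠ 0 := by
    exact_mod_cast (Nat.choose_pos hθN).ne'
  have hall : ∀ᵐ ω ∂μ, ∀ s ∈ piAntidiag (univ : Finset (Fin (k + 1))) (θ - 1),
      (μ[I s | m]) ω = (∏ j, ((y ω j).choose (s j) : ℝ)) / (N.choose (θ - 1) : ℝ) := by
    rw [Finset.eventually_all]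
    intro s hs
    exact hcond s (by simpa using hs)
  have hone : ∀ᵐ ω ∂μ, ∑ s ∈ piAntidiag univ (θ - 1), (μ[I s | m]) ω = 1 := by
    filter_upwards [hall, htot] with ω h1 h2
    rw [Finset.sum_congr rfl h1, ← Finset.sum_div, div_eq_one_iff_eq hC, ← h2,
      ← sum_piAntidiag_prod_choose]
    push_cast; rfl
  have hintegral : ∫ ω, ∑ s ∈ piAntidiag univ (θ - 1), I s ω ∂μ = 1 := by
    rw [integral_finsetSum _ fun s _ => hint s]
    calc ∑ s ∈ piAntidiag univ (θ - 1), ∫ ω, I s ω ∂μ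
        = ∑ s ∈ piAntidiag univ (θ - 1), ∫ ω, (μ[I s | m]) ω ∂μ :=
          Finset.sum_congr rfl fun s _ => (integral_condExp hm).symm
      _ = ∫ ω, ∑ s ∈ piAntidiag univ (θ - 1), (μ[I s | m]) ω ∂μ :=
          (integral_finsetSum _ fun s _ => integrable_condExp).symm
      _ = ∫ _, (1 : ℝ) ∂μ := integral_congr_ae hone
      _ = 1 := by simp
  have hle : ∀ ω, ∑ s ∈ piAntidiag univ (θ - 1), I s ω ≤ 1 := by
    intro ω
    simp only [hI, Finset.sum_boole]
    rw [Nat.cast_le_one, Finset.card_le_one]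
    intro s hs t ht
    simp only [mem_filter, mem_piAntidiag] at hs ht
    exact replVecZ_inj hk (hs.1.1.trans ht.1.1.symm) fun j => by
      linarith [hs.2 j, ht.2 j]
  have hsumint : Integrable (fun ω => ∑ s ∈ piAntidiag univ (θ - 1), I s ω) μ :=
    integrable_finsetSum _ fun s _ => hint s
  have hzero : ∫ ω, (1 - ∑ s ∈ piAntidiag univ (θ - 1), I s ω) ∂μ = 0 := by
    rw [integral_sub (integrable_const _) hsumint, hintegral]; simp
  rw [integral_eq_zero_iff_of_nonneg (fun ω => sub_nonneg.2 (hle ω))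
    ((integrable_const _).sub hsumint)] at hzero
  filter_upwards [hzero] with ω hω
  by_contra! hne
  have : ∑ s ∈ piAntidiag univ (θ - 1), I s ω = 0 := by
    refine Finset.sum_eq_zero fun s hs => if_neg ?_
    push Not
    exact hne s hs
  simp [this] at hω

/-- For the global containment profile process `(Y_n)` of the
hyperrecursive tree with parameter `θ ≥ 2`, truncated at level `k ≥ 1` (an adapted
`ℕ^{k+1}`-valued process with `Y_0 = (θ, 0, …, 0)` and multivariate-hypergeometric
transition probabilities `P(Y_n = Y_{n−1} + a_s | F_{n−1}) =
(Π_j C(Y_{n−1,j}, s_j)) / C(n−1+θ, θ−1)` for every `s ∈ Δ`), one has for every `n ≥ 1`,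
almost surely and coordinatewise,
`E[Y_n | F_{n−1}] = Y_{n−1}(I_{k+1} + (1/(n−1+θ)) A)`. -/
theorem hyperrecursive_profile_conditional_expectation
    {Ω : Type*} {m0 : MeasurableSpace Ω} {μ : Measure Ω} [IsProbabilityMeasure μ]
    (θ k : ℕ) (hθ : 2 ≤ θ) (hk : 1 ≤ k)
    (F : ℕ → MeasurableSpace Ω) (hFle : ∀ n, F n ≤ m0) (hFmono : Monotone F)
    (Y : ℕ → Ω → Fin (k + 1) → ℕ)
    (hYadapted : ∀ n, Measurable[F n] (Y n))
    (hY0 : ∀ ω, Y 0 ω = fun i => if i.val = 0 then θ else 0)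
    (hcond : ∀ n, 1 ≤ n → ∀ s : Fin (k + 1) → ℕ, (∑ i, s i = θ - 1) →
      (μ[(fun ω => if (∀ j : Fin (k + 1),
            (Y n ω j : ℤ) = (Y (n - 1) ω j : ℤ) + replVecZ k s j)
          then (1 : ℝ) else 0) | F (n - 1)]) =ᵐ[μ]
        (fun ω => (∏ j, ((Y (n - 1) ω j).choose (s j) : ℝ)) /
          ((n - 1 + θ).choose (θ - 1) : ℝ))) :
    ∀ n, 1 ≤ n → ∀ j : Fin (k + 1),
      (μ[(fun ω => (Y n ω j : ℝ)) | F (n - 1)]) =ᵐ[μ]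
        (fun ω => (Y (n - 1) ω j : ℝ) +
          (1 / (((n : ℝ) - 1) + θ)) *
            ∑ i : Fin (k + 1), (Y (n - 1) ω i : ℝ) * (coreMatrix θ k i j : ℝ)) := by
  have hmeas : ∀ n, Measurable (Y n) := fun n => (hYadapted n).mono (hFle n) le_rfl
  have hint : ∀ n, ∀ s : Fin (k + 1) → ℕ, Integrable (fun ω => if (∀ j : Fin (k + 1),
      (Y n ω j : ℤ) = (Y (n - 1) ω j : ℤ) + replVecZ k s j) then (1 : ℝ) else 0) μ := by
    intro n s
    have hset : MeasurableSet {ω | ∀ j : Fin (k + 1),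
        (Y n ω j : ℤ) = (Y (n - 1) ω j : ℤ) + replVecZ k s j} :=
      ((hmeas n).prodMk (hmeas (n - 1))) (MeasurableSet.of_discrete
        (s := {p : (Fin (k + 1) → ℕ) × (Fin (k + 1) → ℕ) |
          ∀ j, (p.1 j : ℤ) = (p.2 j : ℤ) + replVecZ k s j}))
    refine Integrable.of_bound (Measurable.ite hset measurable_const
      measurable_const).aestronglyMeasurable 1 (Filter.Eventually.of_forall fun ω => ?_)
    split_ifs <;> simp
  have hstep : ∀ n, 1 ≤ n → (∀ᵐ ω ∂μ, ∑ j, Y (n - 1) ω j = n - 1 + θ) →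
      ∀ᵐ ω ∂μ, ∃ s ∈ piAntidiag univ (θ - 1),
        ∀ j, (Y n ω j : ℤ) = (Y (n - 1) ω j : ℤ) + replVecZ k s j := fun n hn htot =>
    ae_exists_replVecZ hk (by omega) (hFle (n - 1)) (hint n) (hcond n hn) htot
  have htot : ∀ n, ∀ᵐ ω ∂μ, ∑ j, Y n ω j = n + θ := by
    intro n
    induction n with
    | zero =>
      refine Filter.Eventually.of_forall fun ω => ?_
      rw [hY0, Fin.sum_univ_succ]
      simp
    | succ n ih =>
      filter_upwards [hstep (n + 1) (by omega) ih, ih] with ω ⟨s, _, hs⟩ hω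
      have h : ∑ j, (Y (n + 1) ω j : ℤ) = ∑ j, (Y n ω j : ℤ) + 1 := by
        rw [← sum_replVecZ hk s, ← Finset.sum_add_distrib]
        exact Finset.sum_congr rfl fun j _ => hs j
      zify at hω ⊢
      rw [h, hω]
      ring
  have hYint : ∀ n j, Integrable (fun ω => (Y n ω j : ℝ)) μ := by
    intro n j
    refine Integrable.of_bound ((measurable_from_top.comp
      ((measurable_pi_apply j).comp (hmeas n))).aestronglyMeasurable) ((n + θ : ℕ) : ℝ) ?_
    filter_upwards [htot n] with ω hω
    rw [Real.norm_natCast, Nat.cast_le, ← hω]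
    exact Finset.single_le_sum (f := fun j => Y n ω j) (fun _ _ => Nat.zero_le _)
      (Finset.mem_univ j)
  intro n hn j
  have htot' : ∀ᵐ ω ∂μ, ∑ j, Y (n - 1) ω j = n - 1 + θ := htot (n - 1)
  set I : (Fin (k + 1) → ℕ) → Ω → ℝ := fun s ω => if (∀ j : Fin (k + 1),
      (Y n ω j : ℤ) = (Y (n - 1) ω j : ℤ) + replVecZ k s j) then (1 : ℝ) else 0 with hI
  have hdecomp : (fun ω => (Y n ω j : ℝ)) =ᵐ[μ] (fun ω => (Y (n - 1) ω j : ℝ)) +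
      ∑ s ∈ piAntidiag univ (θ - 1), (replVecZ k s j : ℝ) • I s := by
    filter_upwards [hstep n hn htot'] with ω ⟨s, hs, hω⟩
    simp only [Pi.add_apply, Finset.sum_apply, Pi.smul_apply, smul_eq_mul]
    rw [Finset.sum_eq_single_of_mem s hs]
    · simp only [hI, if_pos hω, mul_one]
      exact_mod_cast hω j
    · intro t ht hts
      have hne : ¬ ∀ j, (Y n ω j : ℤ) = (Y (n - 1) ω j : ℤ) + replVecZ k t j := by
        intro h
        simp only [mem_piAntidiag] at hs ht
        exact hts (replVecZ_inj hk (ht.1.trans hs.1.symm) fun j => by linarith [h j, hω j])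
      simp only [hI, if_neg hne, mul_zero]
  have hself : μ[(fun ω => (Y (n - 1) ω j : ℝ)) | F (n - 1)] = fun ω => (Y (n - 1) ω j : ℝ) :=
    condExp_of_stronglyMeasurable (hFle _) (measurable_from_top.comp
      ((measurable_pi_apply j).comp (hYadapted (n - 1)))).stronglyMeasurable (hYint _ j)
  have hall : ∀ᵐ ω ∂μ, ∀ s ∈ piAntidiag (univ : Finset (Fin (k + 1))) (θ - 1),
      (μ[(replVecZ k s j : ℝ) • I s | F (n - 1)]) ω = (replVecZ k s j : ℝ) *
        ((∏ j, ((Y (n - 1) ω j).choose (s j) : ℝ)) / ((n - 1 + θ).choose (θ - 1) : ℝ)) := by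
    rw [Finset.eventually_all]
    intro s hs
    filter_upwards [hcond n hn s (by simpa using hs),
      condExp_smul (μ := μ) (replVecZ k s j : ℝ) (I s) (F (n - 1))] with ω h1 h2
    rw [h2, Pi.smul_apply, smul_eq_mul, h1]
  have hsmul : ∀ s ∈ piAntidiag univ (θ - 1), Integrable ((replVecZ k s j : ℝ) • I s) μ :=
    fun s _ => (hint n s).smul _
  filter_upwards [condExp_congr_ae (m := F (n - 1)) hdecomp,
    condExp_add (hYint (n - 1) j) (integrable_finsetSum' _ hsmul) (F (n - 1)),
    condExp_finsetSum hsmul (F (n - 1)), hall, htot'] with ω h1 h2 h3 h4 h5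
  rw [h1, h2, Pi.add_apply, h3, hself, Finset.sum_apply, Finset.sum_congr rfl h4,
    sum_replVecZ_mul_prod_choose (by omega) hk (Y (n - 1) ω) (by omega) (by omega) h5 j]
  push_cast [Nat.cast_sub hn]
  rfl
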